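/- Let D, n > 0 and let e₀, e₁, …, eₙ be n+1 distinct integers with 0 ≤ eᵢ ≤ D. If λ ≥ max(21, 3n·log₂ D) and p is a prime chosen uniformly at random from the primes in the open interval (λ, 2λ), then with probability at least 1/2, e₀ is not congruent to any of e₁, …, eₙ modulo p. -/

import Mathlib

theorem three_mul_div_add_two_mul_div_le (n q : ℕ) :
    3 * n / q + 2 * (2 * n / q) ≤ 6 * n / q + n / q := by
  rcases Nat.eq_zero_or_pos q with rfl | hq
  · simp
  obtain ⟨k, r, hr, rfl⟩ : ∃ k r, r < q ∧ n = q * k + r :=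
    ⟨n / q, n % q, Nat.mod_lt _ hq, (Nat.div_add_mod n q).symm⟩
  have key (a : ℕ) : a * (q * k + r) / q = a * k + a * r / q := by
    rw [show a * (q * k + r) = a * r + q * (a * k) by ring, Nat.add_mul_div_left _ _ hq, add_comm]
  have key_one : (q * k + r) / q = k := by
    rw [Nat.mul_add_div hq, Nat.div_eq_of_lt hr, add_zero]
  have h₂ : 2 * r / q < 2 := by rw [Nat.div_lt_iff_lt_mul hq]; lia
  have h₃ : 3 * r / q < 3 := by rw [Nat.div_lt_iff_lt_mul hq]; lia
  have l₂ := Nat.div_mul_le_self (2 * r) q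
  have l₃ := Nat.div_mul_le_self (3 * r) q
  suffices 3 * r / q + 2 * (2 * r / q) ≤ 6 * r / q by rw [key, key, key, key_one]; lia
  rw [Nat.le_div_iff_mul_le hq]
  generalize 2 * r / q = b at *
  generalize 3 * r / q = c at *
  interval_cases b <;> interval_cases c <;> lia

open Nat in
theorem factorial_mul_factorial_sq_dvd (n : ℕ) :
    (3 * n)! * ((2 * n)! * (2 * n)!) ∣ (6 * n)! * n ! := by
  have pos := Nat.factorial_ne_zero
  rw [← Nat.factorization_prime_le_iff_dvd (by simp [pos]) (by simp [pos])]
  intro p hp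
  have hlog (a : ℕ) (ha : a ≤ 6 * n) : log p a < log p (6 * n) + 1 :=
    Nat.lt_succ_of_le (Nat.log_mono_right ha)
  simp only [Nat.factorization_mul, pos, ne_eq, mul_eq_zero, or_self, not_false_eq_true,
    Finsupp.add_apply]
  rw [factorization_factorial hp (hlog (3 * n) (by lia)),
    factorization_factorial hp (hlog (2 * n) (by lia)),
    factorization_factorial hp (hlog (6 * n) le_rfl),
    factorization_factorial hp (hlog n (by lia)), ← Finset.sum_add_distrib,
    ← Finset.sum_add_distrib, ← Finset.sum_add_distrib]
  refine Finset.sum_le_sum fun i _ ↦ ?_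
  have := three_mul_div_add_two_mul_div_le n (p ^ i)
  lia

open Nat in
theorem factorial_six_mul_le (n : ℕ) :
    (6 * n)! * n ! ≤ 108 ^ n * ((3 * n)! * ((2 * n)! * (2 * n)!)) := by
  induction n with
  | zero => simp
  | succ n ih =>
    have h₆ : (6 * (n + 1))! = (6 * n + 6) * (6 * n + 5) * (6 * n + 4) * (6 * n + 3) *
        (6 * n + 2) * (6 * n + 1) * (6 * n)! := by
      rw [show 6 * (n + 1) = 6 * n + 5 + 1 by ring]
      simp only [Nat.factorial_succ]; ring
    have h₃ : (3 * (n + 1))! = (3 * n + 3) * (3 * n + 2) * (3 * n + 1) * (3 * n)! := by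
      rw [show 3 * (n + 1) = 3 * n + 2 + 1 by ring]
      simp only [Nat.factorial_succ]; ring
    have h₂ : (2 * (n + 1))! = (2 * n + 2) * (2 * n + 1) * (2 * n)! := by
      rw [show 2 * (n + 1) = 2 * n + 1 + 1 by ring]
      simp only [Nat.factorial_succ]; ring
    have hc : (6 * n + 6) * (6 * n + 5) * (6 * n + 4) * (6 * n + 3) * (6 * n + 2) * (6 * n + 1) *
        (n + 1) ≤ 108 * ((3 * n + 3) * (3 * n + 2) * (3 * n + 1) *
        (((2 * n + 2) * (2 * n + 1)) * ((2 * n + 2) * (2 * n + 1)))) := by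
      ring_nf; gcongr <;> norm_num
    rw [h₆, h₃, h₂, Nat.factorial_succ, pow_succ]
    calc _ = ((6 * n + 6) * (6 * n + 5) * (6 * n + 4) * (6 * n + 3) * (6 * n + 2) * (6 * n + 1) *
        (n + 1)) * ((6 * n)! * n !) := by ring
      _ ≤ _ := Nat.mul_le_mul hc ih
      _ = _ := by ring

open Nat in
theorem primorial_six_mul_le (n : ℕ) : primorial (6 * n) ≤ primorial (2 * n) * 108 ^ n := by
  obtain ⟨A, hA⟩ := factorial_mul_factorial_sq_dvd n
  have hA_le : A ≤ 108 ^ n := by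
    have := factorial_six_mul_le n
    rw [hA, mul_comm (108 ^ n)] at this
    exact Nat.le_of_mul_le_mul_left this (by positivity)
  have hA_pos : 0 < A := by
    rcases Nat.eq_zero_or_pos A with rfl | h
    · have : 0 < (6 * n)! * n ! := by positivity
      lia
    · exact h
  have h₆ := Nat.choose_mul_factorial_mul_factorial (show 3 * n ≤ 6 * n by lia)
  have h₃ := Nat.choose_mul_factorial_mul_factorial (show n ≤ 3 * n by lia)
  have h₂ := Nat.choose_mul_factorial_mul_factorial (show n ≤ 2 * n by lia)
  rw [show 6 * n - 3 * n = 3 * n by lia] at h₆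
  rw [show 3 * n - n = 2 * n by lia] at h₃
  rw [show 2 * n - n = n by lia] at h₂
  have hchoose : A * (2 * n).choose n = (6 * n).choose (3 * n) * (3 * n).choose n := by
    have hpos : 0 < (3 * n)! * (2 * n)! * n ! * n ! := by positivity
    refine Nat.eq_of_mul_eq_mul_right hpos ?_
    calc _ = A * (3 * n)! * (2 * n)! * ((2 * n).choose n * n ! * n !) := by ring
      _ = (6 * n)! * n ! := by rw [h₂, hA]; ring
      _ = (6 * n).choose (3 * n) * (3 * n)! * (3 * n)! * n ! := by rw [h₆]
      _ = (6 * n).choose (3 * n) * (3 * n)! * ((3 * n).choose n * n ! * (2 * n)!) * n ! := by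
        rw [h₃]
      _ = _ := by ring
  rw [show 6 * n = 2 * n + 4 * n by ring, primorial_add]
  refine Nat.mul_le_mul_left _ (le_trans (Nat.le_of_dvd hA_pos ?_) hA_le)
  refine Finset.prod_primes_dvd _ (fun p hp ↦ (Finset.mem_filter.1 hp).2.prime) fun p hp ↦ ?_
  rw [Finset.mem_filter, Finset.mem_Ico] at hp
  obtain ⟨⟨hlo, hhi⟩, hp⟩ := hp
  have hdvd : p ∣ A * (2 * n).choose n := by
    rw [hchoose]
    rcases le_or_gt p (3 * n) with h | h
    · exact dvd_mul_of_dvd_right (hp.dvd_choose (by lia) (by lia) h) _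
    · exact dvd_mul_of_dvd_left (hp.dvd_choose (by lia) (by lia) (by lia)) _
  refine (hp.dvd_mul.1 hdvd).resolve_right fun h ↦ ?_
  have : p ∣ (2 * n)! := h₂ ▸ dvd_mul_of_dvd_left (dvd_mul_of_dvd_left h _) _
  have := hp.dvd_factorial.1 this
  lia

theorem primorial_pow_four_le_of_lt {n : ℕ} (hn : n < 216) : primorial n ^ 4 ≤ 128 ^ n := by
  have hsmall : ∀ n < 12, primorial n ^ 4 ≤ 128 ^ n := by decide +kernel
  have hblock : ∀ j < 34, primorial (6 * j + 17) ^ 4 ≤ 128 ^ (6 * j + 12) := by decide +kernel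
  rcases lt_or_ge n 12 with h | h
  · exact hsmall n h
  · calc primorial n ^ 4 ≤ primorial (6 * ((n - 12) / 6) + 17) ^ 4 := by
          gcongr; exact primorial_mono (by lia)
      _ ≤ 128 ^ (6 * ((n - 12) / 6) + 12) := hblock _ (by lia)
      _ ≤ 128 ^ n := by gcongr <;> lia

theorem primorial_pow_four_le (n : ℕ) : primorial n ^ 4 ≤ 128 ^ n := by
  induction n using Nat.strong_induction_on with
  | _ n ih =>
    rcases lt_or_ge n 216 with h | h
    · exact primorial_pow_four_le_of_lt h
    obtain ⟨k, hk, hk'⟩ : ∃ k, n ≤ 6 * k ∧ 6 * k ≤ n + 5 := ⟨(n + 5) / 6, by lia, by lia⟩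
    obtain ⟨j, rfl⟩ : ∃ j, k = 36 + j := ⟨k - 36, by lia⟩
    have hpow : (108 ^ (36 + j)) ^ 4 * 128 ^ 5 ≤ (128 ^ (36 + j)) ^ 4 := by
      have hbase : (108 ^ 36) ^ 4 * 128 ^ 5 ≤ (128 ^ 36) ^ 4 := by norm_num
      have hj : (108 ^ j) ^ 4 ≤ (128 ^ j) ^ 4 := by gcongr; norm_num
      calc _ = ((108 ^ 36) ^ 4 * 128 ^ 5) * (108 ^ j) ^ 4 := by ring
        _ ≤ (128 ^ 36) ^ 4 * (128 ^ j) ^ 4 := Nat.mul_le_mul hbase hj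
        _ = _ := by ring
    refine Nat.le_of_mul_le_mul_right (c := 128 ^ 5) ?_ (by positivity)
    calc primorial n ^ 4 * 128 ^ 5
        ≤ (primorial (2 * (36 + j)) * 108 ^ (36 + j)) ^ 4 * 128 ^ 5 := by
          gcongr
          exact (primorial_mono hk).trans (primorial_six_mul_le _)
      _ = primorial (2 * (36 + j)) ^ 4 * ((108 ^ (36 + j)) ^ 4 * 128 ^ 5) := by ring
      _ ≤ 128 ^ (2 * (36 + j)) * (128 ^ (36 + j)) ^ 4 :=
        Nat.mul_le_mul (ih _ (by lia)) hpow
      _ = 128 ^ (6 * (36 + j)) := by rw [← pow_mul, ← pow_add]; congr 1; ring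
      _ ≤ 128 ^ (n + 5) := by gcongr; norm_num
      _ = _ := pow_add _ _ _

theorem prime_iff_gcd_primorial_eq_one {n k : ℕ} (hk : k < n) (hn : n < (k + 1) ^ 2) :
    n.Prime ↔ n.gcd (primorial k) = 1 := by
  constructor
  · intro h
    refine (h.coprime_iff_not_dvd).2 fun hd ↦ ?_
    have := h.dvd_primorial_iff.1 hd
    lia
  · intro h
    by_contra hp
    rcases eq_or_ne n 1 with rfl | h₁
    · obtain rfl : k = 0 := by lia
      simp at hn
    have hmf := Nat.minFac_prime h₁
    have hle : n.minFac ≤ k := by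
      have := Nat.minFac_sq_le_self (by lia) hp
      by_contra! hc
      have : (k + 1) ^ 2 ≤ n.minFac ^ 2 := by gcongr; lia
      lia
    exact Nat.not_coprime_of_dvd_of_dvd hmf.one_lt n.minFac_dvd
      (hmf.dvd_primorial_iff.2 hle) h

/-- The primes `p` with `m < p ≤ 2 * m`. -/
def dyadicPrimes (m : ℕ) : Finset ℕ := {p ∈ Finset.Ioc m (2 * m) | p.Prime}

theorem card_dyadicPrimes_succ {m : ℕ} (hm : 0 < m) :
    (dyadicPrimes (m + 1)).card =
      (dyadicPrimes m).card + (if (2 * m + 1).Prime then 1 else 0) -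
        (if (m + 1).Prime then 1 else 0) := by
  have hnot : ¬ (2 * m + 2).Prime := by
    rw [show 2 * m + 2 = 2 * (m + 1) by ring]
    exact Nat.not_prime_mul (by lia) (by lia)
  have hIoc : insert (m + 1) (Finset.Ioc (m + 1) (2 * (m + 1))) =
      insert (2 * m + 2) (insert (2 * m + 1) (Finset.Ioc m (2 * m))) := by
    ext; simp only [Finset.mem_insert, Finset.mem_Ioc]; lia
  have h := congrArg (fun s ↦ (s.filter Nat.Prime).card) hIoc
  simp only [Finset.filter_insert, hnot, if_false] at h
  unfold dyadicPrimes
  split_ifs at h ⊢ <;> simp at h ⊢ <;> lia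

/-- Starting from `m` with `N` primes in `(m, 2 * m]`, checks `4 ^ (m + 1) ≤ m ^ (3 * (N + 1))` for
`k` consecutive values of `m`, where a number is taken to be prime when it is coprime to `K`.
Matching on `m` and `N` makes the kernel evaluate them at every step. -/
def checkDyadic (K : ℕ) : ℕ → ℕ → ℕ → Bool
  | 0, _, _ => true
  | k + 1, m + 1, N + 1 => decide (4 ^ (m + 2) ≤ (m + 1) ^ (3 * (N + 2))) &&
      checkDyadic K k (m + 2) (N + 1 + (if (2 * m + 3).gcd K = 1 then 1 else 0) -
        (if (m + 2).gcd K = 1 then 1 else 0))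
  | _ + 1, _, _ => false

theorem le_of_checkDyadic {b : ℕ} (k m : ℕ) (hb : b ≤ m) (hm : 0 < m)
    (hk : 2 * (m + k) ≤ (b + 1) ^ 2)
    (h : checkDyadic (primorial b) k m (dyadicPrimes m).card = true) :
    ∀ i < k, 4 ^ (m + i + 1) ≤ (m + i) ^ (3 * ((dyadicPrimes (m + i)).card + 1)) := by
  induction k generalizing m with
  | zero => simp
  | succ k ih =>
    obtain ⟨m, rfl⟩ := Nat.exists_eq_succ_of_ne_zero hm.ne'
    obtain ⟨N, hN⟩ : ∃ N, (dyadicPrimes (m + 1)).card = N + 1 := by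
      refine Nat.exists_eq_succ_of_ne_zero fun h₀ ↦ ?_
      simp [h₀, checkDyadic] at h
    have hcard := card_dyadicPrimes_succ hm
    simp only [prime_iff_gcd_primorial_eq_one (show b < 2 * (m + 1) + 1 by lia) (by lia),
      prime_iff_gcd_primorial_eq_one (show b < m + 1 + 1 by lia) (by lia), Nat.succ_eq_add_one,
      hN] at hcard
    rw [Nat.succ_eq_add_one, hN, checkDyadic, Bool.and_eq_true, decide_eq_true_eq] at h
    intro i hi
    rcases i with _ | i
    · simpa [hN] using h.1
    · have := ih (m + 2) (by lia) (by lia) (by lia) (by rw [hcard]; exact h.2) i (by lia)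
      rwa [show m + 2 + i = m.succ + (i + 1) by lia] at this

theorem four_pow_le_pow_card_dyadicPrimes_of_lt {m : ℕ} (h₁ : 21 ≤ m) (h₂ : m < 4096) :
    4 ^ (m + 1) ≤ m ^ (3 * ((dyadicPrimes m).card + 1)) := by
  rcases lt_or_ge m 91 with h | h
  · have hK : primorial 20 = 9699690 := by decide +kernel
    have hN : (dyadicPrimes 21).card = 5 := by decide +kernel
    have := le_of_checkDyadic (b := 20) 70 21 (by norm_num) (by norm_num) (by norm_num)
      (by rw [hK, hN]; decide +kernel) (m - 21) (by lia)
    rwa [show 21 + (m - 21) = m by lia] at this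
  · have hK : primorial 90 = 23768741896345550770650537601358310 := by decide +kernel
    have hN : (dyadicPrimes 91).card = 18 := by decide +kernel
    have := le_of_checkDyadic (b := 90) 4005 91 (by norm_num) (by norm_num) (by norm_num)
      (by rw [hK, hN]; decide +kernel) (m - 91) (by lia)
    rwa [show 91 + (m - 91) = m by lia] at this

open Nat in
theorem centralBinom_le_pow_mul_primorial {m : ℕ} (hm : 2 < m) :
    centralBinom m ≤ (2 * m) ^ (primeCounting (sqrt (2 * m)) + (dyadicPrimes m).card) *
      primorial (2 * m / 3) := by
  set f : ℕ → ℕ := fun p ↦ p ^ (centralBinom m).factorization p with hf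
  have hf_le (p : ℕ) : f p ≤ 2 * m := pow_factorization_choose_le (by lia)
  have hf_one (p : ℕ) (h : 2 * m / 3 < p) (h' : p ≤ m) : f p = 1 := by
    simp only [hf]
    rw [factorization_centralBinom_of_two_mul_self_lt_three_mul hm h' (by lia), pow_zero]
  have hprod : centralBinom m = ∏ p ∈ primesLE (2 * m), f p := by
    conv_lhs => rw [← prod_pow_factorization_centralBinom]
    rw [primesLE_eq_filter_range]
    refine (Finset.prod_filter_of_ne fun p _ h ↦ ?_).symm
    contrapose h
    simp [factorization_eq_zero_of_not_prime _ h]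
  have hsub : ∏ p ∈ primesLE (2 * m), f p ≤ ∏ p ∈ primesLE (2 * m),
      (if p ∈ primesLE (sqrt (2 * m)) then 2 * m else 1) *
      (if p ∈ dyadicPrimes m then 2 * m else 1) * (if p ∈ primesLE (2 * m / 3) then p else 1) := by
    refine Finset.prod_le_prod' fun p hp ↦ ?_
    obtain ⟨hp_le, hp⟩ := mem_primesLE.1 hp
    have h₁ (s : Finset ℕ) : 1 ≤ if p ∈ s then 2 * m else 1 := by split_ifs <;> lia
    have h₂ (s : Finset ℕ) : 1 ≤ if p ∈ s then p else 1 := by split_ifs <;> grind [hp.pos]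
    by_cases hs : p ≤ sqrt (2 * m)
    · rw [if_pos (mem_primesLE.2 ⟨hs, hp⟩), mul_assoc]
      exact (hf_le p).trans (Nat.le_mul_of_pos_right _ (Nat.mul_pos (h₁ _) (h₂ _)))
    by_cases hd : m < p
    · rw [if_pos (show p ∈ dyadicPrimes m by simp [dyadicPrimes, *]), mul_right_comm]
      exact (hf_le p).trans (Nat.le_mul_of_pos_left _ (Nat.mul_pos (h₁ _) (h₂ _)))
    by_cases ht : p ≤ 2 * m / 3
    · rw [if_pos (mem_primesLE.2 ⟨ht, hp⟩)]
      refine le_trans ?_ (Nat.le_mul_of_pos_left _ (Nat.mul_pos (h₁ _) (h₁ _)))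
      refine (Nat.pow_le_pow_right hp.pos ?_).trans (pow_one p).le
      exact factorization_choose_le_one (sqrt_lt'.1 (not_le.1 hs))
    · rw [hf_one p (by lia) (by lia)]
      exact Nat.mul_pos (Nat.mul_pos (h₁ _) (h₁ _)) (h₂ _)
  have hinter (s : Finset ℕ) (hs : ∀ p ∈ s, p ≤ 2 * m ∧ p.Prime) : primesLE (2 * m) ∩ s = s :=
    Finset.inter_eq_right.2 fun p hp ↦ mem_primesLE.2 (hs p hp)
  have hsqrt : sqrt (2 * m) ≤ 2 * m := sqrt_le_self _
  rw [Finset.prod_mul_distrib, Finset.prod_mul_distrib, Finset.prod_ite_mem, Finset.prod_ite_mem,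
    Finset.prod_ite_mem, hinter _ (by grind [mem_primesLE]),
    hinter _ (by grind [dyadicPrimes]), hinter _ (by grind [mem_primesLE]), Finset.prod_const,
    Finset.prod_const, primesLE_card_eq_primeCounting, ← pow_add] at hsub
  exact hprod.trans_le hsub

open Nat in
theorem three_mul_primeCounting_le {t : ℕ} (ht : 6 ≤ t) : 3 * primeCounting t ≤ t + 9 := by
  obtain ⟨n, rfl⟩ := Nat.exists_eq_add_of_le ht
  have h := primeCounting_add_le (show 6 ≠ 0 by norm_num) (le_refl 6) n
  have h₁ : primeCounting 6 = 3 := by decide +kernel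
  have h₂ : totient 6 = 2 := by decide +kernel
  rw [h₁, h₂] at h
  lia

open Real in
theorem sqrt_mul_log_le {m : ℝ} (hm : 4096 ≤ m) :
    (√(2 * m) / 3 + 3) * log (2 * m) ≤ m / 9 * log 2 := by
  have hxx : √(2 * m) ^ 2 = 2 * m := sq_sqrt (by linarith)
  have hx_ge : 90.5 ≤ √(2 * m) := le_sqrt_of_sq_le (by norm_num; linarith)
  generalize √(2 * m) = x at *
  have h₂ := log_two_gt_d9
  have h₂' := log_two_lt_d9
  have hlog : log (2 * m) ≤ 13 * log 2 + 2 * (x / 90.5 - 1) := by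
    have hsplit : log (2 * m) = 2 * log 90.5 + 2 * log (x / 90.5) := by
      rw [← hxx, log_pow, log_div (by linarith) (by norm_num)]; push_cast; ring
    have h₁ : 2 * log (90.5 : ℝ) ≤ 13 * log 2 := by
      have := log_le_log (by norm_num) (show (90.5 : ℝ) ^ 2 ≤ 2 ^ 13 by norm_num)
      rw [log_pow, log_pow] at this
      exact_mod_cast this
    have := log_le_sub_one_of_pos (show 0 < x / 90.5 by positivity)
    linarith
  calc (x / 3 + 3) * log (2 * m) ≤ (x / 3 + 3) * (9.011 + 2 * (x / 90.5 - 1)) := by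
        gcongr; linarith
    _ ≤ x ^ 2 / 18 * 0.693 := by
      obtain ⟨y, hy, rfl⟩ : ∃ y, 0 ≤ y ∧ x = y + 90.5 := ⟨x - 90.5, by linarith, by ring⟩
      ring_nf
      nlinarith [mul_nonneg hy hy]
    _ ≤ x ^ 2 / 18 * log 2 := by gcongr; linarith
    _ = m / 9 * log 2 := by rw [hxx]; ring

open Real in
theorem four_pow_le_pow_card_dyadicPrimes_of_ge {m : ℕ} (hm : 4096 ≤ m) :
    4 ^ (m + 1) ≤ m ^ (3 * ((dyadicPrimes m).card + 1)) := by
  by_contra! hlt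
  set N := (dyadicPrimes m).card with hN
  set s := Nat.primeCounting (Nat.sqrt (2 * m)) with hs
  have hmR : (4096 : ℝ) ≤ m := by exact_mod_cast hm
  have h₂ : 0 < log 2 := log_pos (by norm_num)
  have hL : 12 * log 2 ≤ log m := by
    have := log_le_log (by norm_num) (show (2 : ℝ) ^ 12 ≤ m by norm_num; exact_mod_cast hm)
    rw [log_pow] at this
    exact_mod_cast this
  have h2m : log (2 * m) = log 2 + log m := log_mul (by norm_num) (by positivity)
  have h4 : log 4 = 2 * log 2 := by
    rw [show (4 : ℝ) = 2 ^ 2 by norm_num, log_pow]; norm_num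
  have hprim : log (primorial (2 * m / 3)) ≤ 7 / 6 * m * log 2 := by
    have h := primorial_pow_four_le (2 * m / 3)
    have h' : ((primorial (2 * m / 3) : ℕ) : ℝ) ^ 4 ≤ (2 ^ 7) ^ (2 * m / 3) := by
      norm_num; exact_mod_cast h
    have h'' := log_le_log (by have := primorial_pos (2 * m / 3); positivity) h'
    rw [log_pow, log_pow, log_pow] at h''
    have hdiv : ((2 * m / 3 : ℕ) : ℝ) ≤ 2 * m / 3 := by
      simpa using Nat.cast_div_le (α := ℝ) (m := 2 * m) (n := 3)
    push_cast at h''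
    nlinarith
  have hbinom : m * (2 * log 2) ≤ log m + (s + N) * log (2 * m) + 7 / 6 * m * log 2 := by
    have h := (Nat.four_pow_lt_mul_centralBinom m (by lia)).le.trans
      (Nat.mul_le_mul_left m (centralBinom_le_pow_mul_primorial (by lia)))
    have h' : (4 : ℝ) ^ m ≤ m * ((2 * m) ^ (s + N) * primorial (2 * m / 3)) := by
      exact_mod_cast h
    have hpos : (0 : ℝ) < primorial (2 * m / 3) := by exact_mod_cast primorial_pos _
    have h'' := log_le_log (by positivity) h'
    rw [log_mul (by positivity) (by positivity), log_mul (by positivity) (by positivity), log_pow,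
      log_pow, h4] at h''
    push_cast at h''
    linarith
  have hup : 3 * (N + 1) * log m ≤ (m + 1) * (2 * log 2) := by
    have h' : (m : ℝ) ^ (3 * (N + 1)) ≤ 4 ^ (m + 1) := by exact_mod_cast hlt.le
    have h'' := log_le_log (by positivity) h'
    rw [log_pow, log_pow, h4] at h''
    exact_mod_cast h''
  have hs_le : (s : ℝ) ≤ √(2 * m) / 3 + 3 := by
    have h6 : 6 ≤ Nat.sqrt (2 * m) := Nat.le_sqrt.2 (by lia)
    have h : (3 * s : ℝ) ≤ Nat.sqrt (2 * m) + 9 := by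
      exact_mod_cast three_mul_primeCounting_le h6
    have : (Nat.sqrt (2 * m) : ℝ) ≤ √(2 * m) := by
      exact_mod_cast Real.nat_sqrt_le_real_sqrt (a := 2 * m)
    linarith
  have hs_log : s * log (2 * m) ≤ m / 9 * log 2 :=
    (mul_le_mul_of_nonneg_right hs_le (by linarith)).trans (sqrt_mul_log_le hmR)
  have hN_log : 36 * (N + 1) * log (2 * m) ≤ 26 * (m + 1) * log 2 := by
    have : 12 * log (2 * m) ≤ 13 * log m := by linarith
    nlinarith
  nlinarith

theorem four_pow_le_pow_card_dyadicPrimes {m : ℕ} (hm : 21 ≤ m) :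
    4 ^ (m + 1) ≤ m ^ (3 * ((dyadicPrimes m).card + 1)) :=
  (lt_or_ge m 4096).elim (four_pow_le_pow_card_dyadicPrimes_of_lt hm)
    four_pow_le_pow_card_dyadicPrimes_of_ge

theorem prod_primes_of_modEq_le_pow {n D : ℕ} {e : Fin (n + 1) → ℕ} (he : Function.Injective e)
    (heD : ∀ i, e i ≤ D) {S : Finset ℕ}
    (hS : ∀ p ∈ S, p.Prime ∧ ∃ i, i ≠ 0 ∧ e 0 ≡ e i [MOD p]) :
    ∏ p ∈ S, p ≤ D ^ n := by
  set d : Fin n → ℕ := fun i ↦ Nat.dist (e 0) (e i.succ) with hd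
  have hd_pos (i : Fin n) : 0 < d i :=
    Nat.dist_pos_of_ne fun h ↦ (Fin.succ_ne_zero i) (he h).symm
  have hd_le (i : Fin n) : d i ≤ D := by
    have := heD 0
    have := heD i.succ
    simp only [hd, Nat.dist]
    lia
  calc ∏ p ∈ S, p ≤ ∏ i, d i := by
        refine Nat.le_of_dvd (Finset.prod_pos fun i _ ↦ hd_pos i) ?_
        refine Finset.prod_primes_dvd _ (fun p hp ↦ (hS p hp).1.prime) fun p hp ↦ ?_
        obtain ⟨-, i, hi, hmod⟩ := hS p hp
        obtain ⟨j, rfl⟩ := Fin.exists_succ_eq.2 hi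
        refine dvd_trans ?_ (Finset.dvd_prod_of_mem d (Finset.mem_univ j))
        rcases le_total (e 0) (e j.succ) with h | h
        · simpa [hd, Nat.dist_eq_sub_of_le h] using (Nat.modEq_iff_dvd' h).1 hmod
        · simpa [hd, Nat.dist_eq_sub_of_le_right h] using (Nat.modEq_iff_dvd' h).1 hmod.symm
    _ ≤ ∏ _i : Fin n, D := Finset.prod_le_prod' fun i _ ↦ hd_le i
    _ = D ^ n := by simp

/-- Lemma 3.2: with probability at least 1/2 over a uniformly random prime
`p ∈ (λ, 2λ)`, the exponent `e 0` collides with none of `e 1, …, e n` modulo `p`. -/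
theorem no_collision_half_of_primes (D n : ℕ) (hD : 0 < D) (hn : 0 < n)
    (e : Fin (n + 1) → ℕ) (he : Function.Injective e) (heD : ∀ i, e i ≤ D)
    (lam : ℝ) (hlam : lam ≥ max 21 (3 * n * Real.logb 2 D)) :
    let P := (Finset.range (Nat.ceil (2 * lam) + 1)).filter
      (fun p : ℕ => Nat.Prime p ∧ lam < (p : ℝ) ∧ (p : ℝ) < 2 * lam)
    (P.filter (fun p => ∀ i : Fin (n + 1), i ≠ 0 → ¬ (e 0 ≡ e i [MOD p]))).card * 2
      ≥ P.card := by
  intro P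
  have h21 : 21 ≤ lam := (le_max_left _ _).trans hlam
  have hlogb : 3 * n * Real.logb 2 D ≤ lam := (le_max_right _ _).trans hlam
  set m := ⌊lam⌋₊ with hm
  have hm21 : 21 ≤ m := Nat.le_floor (by exact_mod_cast h21)
  have hm_le : (m : ℝ) ≤ lam := Nat.floor_le (by linarith)
  have hm_lt : lam < m + 1 := Nat.lt_floor_add_one lam
  have hsub : dyadicPrimes m ⊆ P := by
    intro p hp
    simp only [dyadicPrimes, Finset.mem_filter, Finset.mem_Ioc] at hp
    obtain ⟨⟨hlo, hhi⟩, hp⟩ := hp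
    have hne : p ≠ 2 * m := by
      rintro rfl
      exact Nat.not_prime_mul (by norm_num) (by lia) hp
    have hlo' : (m : ℝ) + 1 ≤ p := by exact_mod_cast hlo
    have hhi' : (p : ℝ) + 1 ≤ 2 * m := by exact_mod_cast (by lia : p + 1 ≤ 2 * m)
    have hlt : (p : ℝ) < 2 * lam := by linarith
    refine Finset.mem_filter.2 ⟨Finset.mem_range.2 ?_, hp, by linarith, hlt⟩
    exact Nat.lt_succ_of_le (Nat.cast_le.1 (hlt.le.trans (Nat.le_ceil _)))
  set bad := P.filter (fun p => ¬ ∀ i : Fin (n + 1), i ≠ 0 → ¬ (e 0 ≡ e i [MOD p])) with hbad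
  have hcard := Finset.card_filter_add_card_filter_not (s := P)
    (fun p => ∀ i : Fin (n + 1), i ≠ 0 → ¬ (e 0 ≡ e i [MOD p]))
  rw [← hbad] at hcard
  have hmem (p : ℕ) (hp : p ∈ bad) : (p.Prime ∧ lam < p) ∧ ∃ i, i ≠ 0 ∧ e 0 ≡ e i [MOD p] := by
    obtain ⟨hpP, hcol⟩ := Finset.mem_filter.1 hp
    push Not at hcol
    exact ⟨⟨(Finset.mem_filter.1 hpP).2.1, (Finset.mem_filter.1 hpP).2.2.1⟩, hcol⟩
  have hprod : m ^ bad.card ≤ D ^ n := by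
    refine le_trans ?_ (prod_primes_of_modEq_le_pow he heD fun p hp ↦ ⟨(hmem p hp).1.1, (hmem p hp).2⟩)
    refine Finset.pow_card_le_prod bad _ m fun p hp ↦ ?_
    exact_mod_cast hm_le.trans (hmem p hp).1.2.le
  have hDpow : D ^ (3 * n) < 2 ^ (m + 1) := by
    have h2 : (D : ℝ) = 2 ^ Real.logb 2 D :=
      (Real.rpow_logb (by norm_num) (by norm_num) (by exact_mod_cast hD)).symm
    have : (D : ℝ) ^ (3 * n) < 2 ^ (m + 1) := by
      rw [h2, ← Real.rpow_natCast, ← Real.rpow_natCast, ← Real.rpow_mul (by norm_num)]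
      refine Real.rpow_lt_rpow_of_exponent_lt (by norm_num) ?_
      push_cast
      linarith
    exact_mod_cast this
  have hbad_card : 2 * bad.card ≤ (dyadicPrimes m).card := by
    by_contra! hlt
    refine absurd (four_pow_le_pow_card_dyadicPrimes hm21) (not_le.2 ?_)
    calc m ^ (3 * ((dyadicPrimes m).card + 1)) ≤ m ^ (bad.card * 6) :=
          Nat.pow_le_pow_right (by lia) (by lia)
      _ = (m ^ bad.card) ^ 6 := pow_mul _ _ _
      _ ≤ (D ^ n) ^ 6 := Nat.pow_le_pow_left hprod 6
      _ = (D ^ (3 * n)) ^ 2 := by rw [← pow_mul, ← pow_mul]; congr 1; ring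
      _ < (2 ^ (m + 1)) ^ 2 := Nat.pow_lt_pow_left hDpow (by norm_num)
      _ = 4 ^ (m + 1) := by rw [← pow_mul, mul_comm, pow_mul]; norm_num
  have := Finset.card_le_card hsub
  lia
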